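/- arXiv:math/0304134 — 4 statements merged into one kernel-verified Lean document; each statement's English description precedes it below -/
import Mathlib

section
/- Let H ∈ (0,1) and γ > 0. Suppose w : (−∞,0] → ℝ is continuous with w(0) = 0 and ‖w‖_{H,γ} := sup_{s,t ≤ 0, s ≠ t} Γ(s,t)^γ |w(s) − w(t)| / (|s−t|^{(1−H)/2} (1 + |t| + |s|)^{1/2}) < ∞, where Γ(s,t) = (1 + |t| + |s|)² / |t−s|. Then for every ε > 0 there exists a smooth compactly supported function w̃ : (−∞,0] → ℝ with w̃(0) = 0 such that ‖w − w̃‖_H < ε. In other words, every function of finite ‖·‖_{H,γ}-norm lies in the closure of the smooth compactly supported functions under the norm ‖·‖_H. -/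
open MeasureTheory Set

/-- The set of difference quotients defining the Hölder-type norm `‖·‖_H`. -/
def holderSet (H : ℝ) (w : ℝ → ℝ) : Set ℝ :=
  {q | ∃ s t : ℝ, s ≤ 0 ∧ t ≤ 0 ∧ s ≠ t ∧
    q = |w t - w s| / (|t - s| ^ ((1 - H) / 2) * (1 + |t| + |s|) ^ ((1 : ℝ) / 2))}

/-- The norm `‖w‖_H`. -/
noncomputable def normH (H : ℝ) (w : ℝ → ℝ) : ℝ := sSup (holderSet H w)

/-- The set of weighted difference quotients defining the stronger norm `‖·‖_{H,γ}`,
with weight `Γ(s,t)^γ` where `Γ(s,t) = (1+|t|+|s|)²/|t-s|`. -/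
def holderGammaSet (H γ : ℝ) (w : ℝ → ℝ) : Set ℝ :=
  {q | ∃ s t : ℝ, s ≤ 0 ∧ t ≤ 0 ∧ s ≠ t ∧
    q = ((1 + |t| + |s|) ^ 2 / |t - s|) ^ γ * |w s - w t| /
      (|s - t| ^ ((1 - H) / 2) * (1 + |t| + |s|) ^ ((1 : ℝ) / 2))}

/-- Global Hölder-type bound. -/
def PB (β κ C : ℝ) (f : ℝ → ℝ) : Prop :=
  ∀ s t : ℝ, |f t - f s| ≤ C * (|t - s| ^ β * (1 + |t| + |s|) ^ κ)

lemma PB_ext (H γ g : ℝ) (hH : H ∈ Set.Ioo (0 : ℝ) 1) (hg : 0 < g) (hgγ : g ≤ γ) (hg8 : g ≤ 1 / 8)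
    (w : ℝ → ℝ) (C : ℝ) (hC : 0 ≤ C) (hw : ∀ q ∈ holderGammaSet H γ w, q ≤ C) :
    PB ((1 - H) / 2 + g) (1 / 2 - 2 * g) C (fun x => w (min x 0)) := by
  obtain ⟨h0, h1⟩ := hH
  have key : ∀ s t : ℝ, s ≤ 0 → t ≤ 0 → |w t - w s| ≤
      C * (|t - s| ^ ((1 - H) / 2 + g) * (1 + |t| + |s|) ^ (1 / 2 - 2 * g)) := by
    intro s t hs ht
    by_cases hst : s = t
    · subst hst
      simp only [sub_self, abs_zero]
      positivity
    have hq := hw _ ⟨s, t, hs, ht, hst, rfl⟩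
    have hd : 0 < |t - s| := abs_pos.2 (sub_ne_zero.2 (Ne.symm hst))
    rw [abs_sub_comm (w s), abs_sub_comm s t] at hq
    have hdA : |t - s| ≤ 1 + |t| + |s| := by linarith [abs_sub t s]
    have hA1 : 1 ≤ 1 + |t| + |s| := by linarith [abs_nonneg t, abs_nonneg s]
    generalize |t - s| = d at *
    generalize 1 + |t| + |s| = A at *
    generalize |w t - w s| = W at *
    have hA : 0 < A := by linarith
    have hG1 : 1 ≤ A ^ 2 / d := by
      rw [le_div_iff₀ hd]; nlinarith
    by_cases hW : W ≤ 0
    · exact hW.trans (by positivity)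
    push Not at hW
    have h2 : (A ^ 2 / d) ^ g ≤ (A ^ 2 / d) ^ γ := Real.rpow_le_rpow_of_exponent_le hG1 hgγ
    have h3 : (A ^ 2 / d) ^ g = A ^ (2 * g) / d ^ g := by
      rw [Real.div_rpow (by positivity) hd.le, Real.rpow_mul hA.le]; norm_num
    rw [div_le_iff₀ (by positivity)] at hq
    have h4 : A ^ (2 * g) / d ^ g * W ≤ C * (d ^ ((1 - H) / 2) * A ^ ((1:ℝ) / 2)) := by
      rw [← h3]; exact (mul_le_mul_of_nonneg_right h2 hW.le).trans hq
    rw [Real.rpow_add hd, Real.rpow_sub hA]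
    have e1 : 0 < A ^ (2 * g) := by positivity
    have e2 : 0 < d ^ g := by positivity
    calc W = (A ^ (2 * g) / d ^ g * W) * (d ^ g / A ^ (2 * g)) := by field_simp
      _ ≤ (C * (d ^ ((1 - H) / 2) * A ^ ((1:ℝ) / 2))) * (d ^ g / A ^ (2 * g)) := by gcongr
      _ = _ := by ring
  intro s t
  refine (key _ _ (min_le_right _ _) (min_le_right _ _)).trans ?_
  have a1 : |min t 0| ≤ |t| := by
    rcases le_total t 0 with h | h <;> simp [h]
  have a2 : |min s 0| ≤ |s| := by
    rcases le_total s 0 with h | h <;> simp [h]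
  have a3 : |min t 0 - min s 0| ≤ |t - s| := by
    simpa using abs_min_sub_min_le_max t 0 s 0
  have : 0 ≤ 1 / 2 - 2 * g := by linarith
  have : 0 ≤ (1 - H) / 2 + g := by linarith
  gcongr

lemma PB_cont (β κ C : ℝ) (hβ : 0 < β) (hκ : 0 < κ) (f : ℝ → ℝ) (hf : PB β κ C f) :
    Continuous f := by
  rw [continuous_iff_continuousAt]
  intro s
  rw [ContinuousAt, tendsto_iff_dist_tendsto_zero]
  have hc : Continuous (fun t : ℝ => C * (|t - s| ^ β * (1 + |t| + |s|) ^ κ)) := by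
    refine continuous_const.mul (Continuous.mul ?_ ?_)
    · exact Continuous.rpow_const (by fun_prop) (fun _ => Or.inr hβ.le)
    · exact Continuous.rpow_const (by fun_prop) (fun _ => Or.inr hκ.le)
  have h := hc.tendsto s
  simp only [sub_self, abs_zero, Real.zero_rpow hβ.ne', zero_mul, mul_zero] at h
  exact squeeze_zero (fun _ => dist_nonneg) (fun t => by rw [Real.dist_eq]; exact hf s t) h

lemma PB_moll (β κ C : ℝ) (hβ : 0 < β) (hκ : 0 < κ) (hκ1 : κ ≤ 1) (hC : 0 ≤ C)
    (v : ℝ → ℝ) (hv : PB β κ C v) (δ : ℝ) (hδ : 0 < δ) (hδ1 : δ ≤ 1) :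
    ∃ F : ℝ → ℝ, ContDiff ℝ (⊤ : ℕ∞) F ∧ PB β κ (3 * C) F ∧
      ∀ x, |F x - v x| ≤ C * (δ ^ β * (2 + 2 * |x|) ^ κ) := by
  have hvc := PB_cont β κ C hβ hκ v hv
  let φ : ContDiffBump (0 : ℝ) := ⟨δ / 2, δ, by positivity, by linarith⟩
  let p : ℝ → ℝ := φ.normed volume
  have hpc : Continuous p := φ.continuous_normed
  have hps : HasCompactSupport p := φ.hasCompactSupport_normed
  have hp0 : ∀ u, 0 ≤ p u := φ.nonneg_normed
  have hpi : Integrable p := φ.integrable_normed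
  have hp1 : ∫ u, p u = 1 := φ.integral_normed
  have hpz : ∀ u, δ ≤ |u| → p u = 0 := by
    intro u hu
    have : u ∉ Function.support p := by
      rw [show Function.support p = Metric.ball 0 δ from φ.support_normed_eq]
      simpa using hu
    simpa using this
  have hint : ∀ x, Integrable (fun u => p u * v (x - u)) := by
    intro x
    refine Continuous.integrable_of_hasCompactSupport (by fun_prop) ?_
    exact hps.mul_right
  refine ⟨fun x => ∫ u, p u * v (x - u), ?_, ?_, ?_⟩
  · have := hps.contDiff_convolution_left (n := (⊤ : ℕ∞)) (ContinuousLinearMap.mul ℝ ℝ)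
      (μ := volume) φ.contDiff_normed (hvc.locallyIntegrable)
    exact this
  · intro s t
    set B := 3 * C * (|t - s| ^ β * (1 + |t| + |s|) ^ κ) with hB
    have e : (∫ u, p u * v (t - u)) - (∫ u, p u * v (s - u)) =
        ∫ u, p u * (v (t - u) - v (s - u)) := by
      rw [← integral_sub (hint t) (hint s)]; simp only [mul_sub]
    rw [e, ← Real.norm_eq_abs]
    refine (norm_integral_le_of_norm_le (hpi.mul_const B) (Filter.Eventually.of_forall ?_)).trans ?_
    · intro u
      rw [norm_mul, Real.norm_eq_abs, Real.norm_eq_abs, abs_of_nonneg (hp0 u)]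
      by_cases hu : δ ≤ |u|
      · simp [hpz u hu]
      push Not at hu
      refine mul_le_mul_of_nonneg_left ?_ (hp0 u)
      refine (hv _ _).trans ?_
      have h1 : t - u - (s - u) = t - s := by ring
      rw [h1, hB]
      have h2 : (1 + |t - u| + |s - u|) ^ κ ≤ 3 * (1 + |t| + |s|) ^ κ := by
        calc (1 + |t - u| + |s - u|) ^ κ ≤ (3 * (1 + |t| + |s|)) ^ κ := by
              apply Real.rpow_le_rpow (by positivity) _ hκ.le
              linarith [abs_sub t u, abs_sub s u, abs_nonneg t, abs_nonneg s]
          _ = 3 ^ κ * (1 + |t| + |s|) ^ κ := Real.mul_rpow (by norm_num) (by positivity)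
          _ ≤ 3 * (1 + |t| + |s|) ^ κ := by
              gcongr
              calc (3:ℝ) ^ κ ≤ 3 ^ (1:ℝ) := Real.rpow_le_rpow_of_exponent_le (by norm_num) hκ1
                _ = 3 := by norm_num
      calc _ ≤ C * (|t - s| ^ β * (3 * (1 + |t| + |s|) ^ κ)) := by gcongr
        _ = _ := by ring
    · rw [integral_mul_const, hp1, one_mul]
  · intro x
    set B := C * (δ ^ β * (2 + 2 * |x|) ^ κ) with hB
    have e : (∫ u, p u * v (x - u)) - v x = ∫ u, p u * (v (x - u) - v x) := by
      simp only [mul_sub]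
      rw [integral_sub (hint x) (hpi.mul_const _), integral_mul_const, hp1, one_mul]
    rw [e, ← Real.norm_eq_abs]
    refine (norm_integral_le_of_norm_le (hpi.mul_const B) (Filter.Eventually.of_forall ?_)).trans ?_
    · intro u
      rw [norm_mul, Real.norm_eq_abs, Real.norm_eq_abs, abs_of_nonneg (hp0 u)]
      by_cases hu : δ ≤ |u|
      · simp [hpz u hu]
      push Not at hu
      refine mul_le_mul_of_nonneg_left ?_ (hp0 u)
      refine (hv _ _).trans ?_
      have h1 : |x - u - x| = |u| := by rw [← abs_neg]; congr 1; ring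
      rw [h1, hB]
      have h2 : 1 + |x - u| + |x| ≤ 2 + 2 * |x| := by linarith [abs_sub x u]
      gcongr
    · rw [integral_mul_const, hp1, one_mul]

lemma cutoff : ∃ χ : ℝ → ℝ, ∃ L : ℝ, 0 ≤ L ∧ ContDiff ℝ (⊤ : ℕ∞) χ ∧ HasCompactSupport χ ∧
    (∀ x, 0 ≤ χ x) ∧ (∀ x, χ x ≤ 1) ∧ (∀ x, |x| ≤ 1 → χ x = 1) ∧ (∀ x, 2 ≤ |x| → χ x = 0) ∧
    ∀ β : ℝ, 0 < β → β ≤ 1 → ∀ x y : ℝ, |χ x - χ y| ≤ L * |x - y| ^ β := by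
  let φ : ContDiffBump (0 : ℝ) := ⟨1, 2, by norm_num, by norm_num⟩
  have hφ : ContDiff ℝ (⊤ : ℕ∞) φ := φ.contDiff
  obtain ⟨K, hK⟩ := ContDiff.lipschitzWith_of_hasCompactSupport φ.hasCompactSupport hφ (by simp)
  refine ⟨φ, K + 1, by positivity, hφ, φ.hasCompactSupport, fun x => φ.nonneg, fun x => φ.le_one,
    fun x hx => φ.one_of_mem_closedBall (by simpa using hx),
    fun x hx => φ.zero_of_le_dist (by simpa using hx), ?_⟩
  intro β hβ hβ1 x y
  have h1 : |φ x - φ y| ≤ K * |x - y| := by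
    simpa [Real.dist_eq] using hK.dist_le_mul x y
  have h2 : |φ x - φ y| ≤ 1 := by
    rw [abs_le]; constructor <;> linarith [φ.nonneg (x := x), φ.nonneg (x := y),
      φ.le_one (x := x), φ.le_one (x := y)]
  have hK0 : (0:ℝ) ≤ K := K.2
  rcases le_total |x - y| 1 with h | h
  · have : |x - y| ≤ |x - y| ^ β := by
      rcases (abs_nonneg (x - y)).eq_or_lt with h0 | h0
      · rw [← h0, Real.zero_rpow hβ.ne']
      · simpa using Real.rpow_le_rpow_of_exponent_ge h0 h hβ1
    nlinarith [abs_nonneg (x - y)]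
  · have : 1 ≤ |x - y| ^ β := Real.one_le_rpow h hβ.le
    nlinarith

lemma PB_cut (β κ C L : ℝ) (hβ : 0 < β) (hβ1 : β ≤ 1) (hκ : 0 < κ) (hC : 0 ≤ C) (hL : 0 ≤ L)
    (χ : ℝ → ℝ) (h0 : ∀ x, 0 ≤ χ x) (h1 : ∀ x, χ x ≤ 1) (h2 : ∀ x, 2 ≤ |x| → χ x = 0)
    (hχ : ∀ x y, |χ x - χ y| ≤ L * |x - y| ^ β) (F : ℝ → ℝ) (hF : PB β κ C F) (hF0 : F 0 = 0)
    (R : ℝ) (hR : 0 < R) : PB β κ (C * (1 + 2 * L)) (fun x => χ (x / R) * F x) := by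
  have key : ∀ s t, |s| ≤ 2 * R → |χ (t / R) * F t - χ (s / R) * F s| ≤
      C * (1 + 2 * L) * (|t - s| ^ β * (1 + |t| + |s|) ^ κ) := by
    intro s t hs
    have e : χ (t / R) * F t - χ (s / R) * F s =
      χ (t / R) * (F t - F s) + F s * (χ (t / R) - χ (s / R)) := by ring
    have a1 : |χ (t / R) * (F t - F s)| ≤ C * (|t - s| ^ β * (1 + |t| + |s|) ^ κ) := by
      rw [abs_mul, abs_of_nonneg (h0 _)]
      exact (mul_le_of_le_one_left (abs_nonneg _) (h1 _)).trans (hF s t)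
    have a2 : |F s| ≤ C * ((2 * R ^ β) * (1 + |t| + |s|) ^ κ) := by
      have := hF 0 s
      simp only [hF0, sub_zero, abs_zero, add_zero] at this
      refine this.trans ?_
      have b1 : |s| ^ β ≤ 2 * R ^ β := by
        calc |s| ^ β ≤ (2 * R) ^ β := by gcongr
          _ = 2 ^ β * R ^ β := Real.mul_rpow (by norm_num) hR.le
          _ ≤ 2 * R ^ β := by
              gcongr
              calc (2:ℝ) ^ β ≤ 2 ^ (1:ℝ) := Real.rpow_le_rpow_of_exponent_le (by norm_num) hβ1
                _ = 2 := by norm_num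
      have b2 : (1 + |s|) ^ κ ≤ (1 + |t| + |s|) ^ κ := by
        apply Real.rpow_le_rpow (by positivity) _ hκ.le
        linarith [abs_nonneg t]
      gcongr
    have a3 : |χ (t / R) - χ (s / R)| ≤ L * (|t - s| ^ β / R ^ β) := by
      refine (hχ _ _).trans (le_of_eq ?_)
      rw [← sub_div, abs_div, abs_of_pos hR, Real.div_rpow (abs_nonneg _) hR.le]
    rw [e]
    refine (abs_add_le _ _).trans ?_
    rw [abs_mul (F s)]
    have hRβ : 0 < R ^ β := by positivity
    calc _ ≤ C * (|t - s| ^ β * (1 + |t| + |s|) ^ κ) +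
          (C * ((2 * R ^ β) * (1 + |t| + |s|) ^ κ)) * (L * (|t - s| ^ β / R ^ β)) := by
            gcongr
      _ = _ := by field_simp
  intro s t
  by_cases hs : |s| ≤ 2 * R
  · exact key s t hs
  by_cases ht : |t| ≤ 2 * R
  · have := key t s ht
    rw [abs_sub_comm, abs_sub_comm s t, add_right_comm] at this
    exact this
  push Not at hs ht
  have z : ∀ x, 2 * R < |x| → χ (x / R) = 0 := by
    intro x hx
    apply h2
    rw [abs_div, abs_of_pos hR, le_div_iff₀ hR]; exact hx.le
  simp only [z s hs, z t ht, zero_mul, sub_zero, abs_zero]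
  positivity

lemma quot_bound (α g C K η ε : ℝ) (hα : 0 < α) (hg : 0 < g) (hC : 0 ≤ C) (hK : 1 ≤ K)
    (f : ℝ → ℝ) (hf : PB (α + g) (1 / 2 - 2 * g) C f) (hη : ∀ x, x ≤ 0 → |x| ≤ K → |f x| ≤ η)
    (h1 : C * K ^ (-g) ≤ ε) (h2 : 2 * η * K ^ α ≤ ε) (s t : ℝ) (hs : s ≤ 0) (ht : t ≤ 0)
    (hst : s ≠ t) :
    |f t - f s| / (|t - s| ^ α * (1 + |t| + |s|) ^ ((1 : ℝ) / 2)) ≤ ε := by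
  have hd : 0 < |t - s| := abs_pos.2 (sub_ne_zero.2 (Ne.symm hst))
  have hdA : |t - s| ≤ 1 + |t| + |s| := by linarith [abs_sub t s]
  have hA1 : 1 ≤ 1 + |t| + |s| := by linarith [abs_nonneg t, abs_nonneg s]
  have hA : 0 < 1 + |t| + |s| := by linarith
  have hK0 : 0 < K := by linarith
  rw [div_le_iff₀ (by positivity)]
  have hε : 0 ≤ ε := le_trans (by positivity) h1
  by_cases hG : K ≤ (1 + |t| + |s|) ^ 2 / |t - s|
  · refine (hf s t).trans ?_
    generalize |t - s| = d at *
    generalize 1 + |t| + |s| = A at *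
    have e1 : 0 < A ^ (2 * g) := by positivity
    have e : d ^ (α + g) * A ^ (1 / 2 - 2 * g) =
        (A ^ 2 / d) ^ (-g) * (d ^ α * A ^ ((1:ℝ) / 2)) := by
      rw [Real.rpow_neg (by positivity), Real.div_rpow (by positivity) hd.le,
        Real.rpow_add hd, Real.rpow_sub hA, Real.rpow_mul hA.le]
      norm_num
      field_simp
    have h3 : (A ^ 2 / d) ^ (-g) ≤ K ^ (-g) :=
      Real.rpow_le_rpow_of_nonpos hK0 hG (by linarith)
    rw [e]
    calc _ ≤ C * (K ^ (-g) * (d ^ α * A ^ ((1:ℝ) / 2))) := by gcongr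
      _ = C * K ^ (-g) * (d ^ α * A ^ ((1:ℝ) / 2)) := by ring
      _ ≤ _ := by gcongr
  · push Not at hG
    rw [div_lt_iff₀ hd] at hG
    have hAK : 1 + |t| + |s| ≤ K := by
      by_contra hh
      push Not at hh
      nlinarith
    have hdK : 1 ≤ K * |t - s| := by nlinarith
    have ht' := hη t ht (by linarith [abs_nonneg s])
    have hs' := hη s hs (by linarith [abs_nonneg t])
    have hη0 : 0 ≤ η := (abs_nonneg _).trans ht'
    have q1 : 1 ≤ K ^ α * |t - s| ^ α := by
      rw [← Real.mul_rpow hK0.le hd.le]; exact Real.one_le_rpow hdK hα.le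
    have q2 : 1 ≤ (1 + |t| + |s|) ^ ((1:ℝ) / 2) := Real.one_le_rpow hA1 (by norm_num)
    calc |f t - f s| ≤ 2 * η * 1 * 1 := by linarith [abs_sub (f t) (f s)]
      _ ≤ 2 * η * (K ^ α * |t - s| ^ α) * (1 + |t| + |s|) ^ ((1:ℝ) / 2) := by gcongr
      _ = (2 * η * K ^ α) * (|t - s| ^ α * (1 + |t| + |s|) ^ ((1:ℝ) / 2)) := by ring
      _ ≤ _ := by gcongr

/-- Every continuous function `w : (-∞,0] → ℝ` with `w 0 = 0` and finite
`‖·‖_{H,γ}`-norm lies in the `‖·‖_H`-closure of the smooth compactly supported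
functions vanishing at `0`. -/
theorem stmt4 (H γ : ℝ) (hH : H ∈ Set.Ioo (0 : ℝ) 1) (hγ : 0 < γ)
    (w : ℝ → ℝ) (hw : ContinuousOn w (Set.Iic 0)) (hw0 : w 0 = 0)
    (hfin : BddAbove (holderGammaSet H γ w)) :
    ∀ ε : ℝ, 0 < ε → ∃ w' : ℝ → ℝ, ContDiff ℝ (⊤ : ℕ∞) w' ∧ HasCompactSupport w' ∧
      w' 0 = 0 ∧ normH H (w - w') < ε := by
  intro ε hε
  obtain ⟨C0, hC0⟩ := hfin
  set C := max C0 0 with hCdef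
  have hC : 0 ≤ C := le_max_right _ _
  set g := min γ (1 / 8) with hgdef
  have hg : 0 < g := lt_min hγ (by norm_num)
  have hg8 : g ≤ 1 / 8 := min_le_right _ _
  have hv := PB_ext H γ g hH hg (min_le_left _ _) hg8 w C hC
    (fun q hq => (hC0 hq).trans (le_max_left _ _))
  obtain ⟨hH0, hH1⟩ := hH
  set α := (1 - H) / 2 with hαdef
  have hα : 0 < α := by linarith
  set β := α + g with hβdef
  set κ := 1 / 2 - 2 * g with hκdef
  have hβ : 0 < β := by linarith
  have hβ1 : β ≤ 1 := by linarith
  have hκ : 0 < κ := by linarith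
  have hκ1 : κ ≤ 1 := by linarith
  set v : ℝ → ℝ := fun x => w (min x 0) with hvdef
  have hv0 : v 0 = 0 := by simp [hvdef, hw0]
  obtain ⟨χ, L, hL, χs, χc, χ0, χ1, χone, χzero, χhol⟩ := cutoff
  set C' := C + 3 * C * (1 + 2 * L) with hC'
  have hCp : 0 ≤ C' := by positivity
  have hKlim : Filter.Tendsto (fun K : ℝ => C' * K ^ (-g)) Filter.atTop (nhds (C' * 0)) :=
    (tendsto_rpow_neg_atTop hg).const_mul C'
  rw [mul_zero] at hKlim
  obtain ⟨K, hK1, hK⟩ := ((Filter.eventually_ge_atTop (1:ℝ)).and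
    (hKlim.eventually (ge_mem_nhds (show (0:ℝ) < ε / 2 by positivity)))).exists
  have hK0 : 0 < K := by linarith
  have hδlim : Filter.Tendsto (fun δ : ℝ => 4 * (C * (δ ^ β * (2 + 2 * K) ^ κ)) * K ^ α)
      (nhdsWithin 0 (Set.Ioi 0)) (nhds 0) := by
    have hc : Continuous (fun δ : ℝ => 4 * (C * (δ ^ β * (2 + 2 * K) ^ κ)) * K ^ α) := by
      have : Continuous (fun δ : ℝ => δ ^ β) :=
        Continuous.rpow_const continuous_id (fun _ => Or.inr hβ.le)
      fun_prop
    have h := hc.tendsto 0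
    simp only [Real.zero_rpow hβ.ne', zero_mul, mul_zero] at h
    exact h.mono_left nhdsWithin_le_nhds
  obtain ⟨δ, hδε, hδ0, hδ1⟩ := ((hδlim.eventually (ge_mem_nhds (show (0:ℝ) < ε / 2 by positivity))).and
    (Ioc_mem_nhdsGT (show (0:ℝ) < 1 by norm_num))).exists
  obtain ⟨F, Fs, FP, Fv⟩ := PB_moll β κ C hβ hκ hκ1 hC v hv δ hδ0 hδ1
  set E := C * (δ ^ β * (2 + 2 * K) ^ κ) with hE
  have GP : PB β κ (3 * C) (fun x => F x - F 0) := by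
    intro s t; simpa using FP s t
  have hcut := PB_cut β κ (3 * C) L hβ hβ1 hκ (by positivity) hL χ χ0 χ1 χzero (χhol β hβ hβ1)
    (fun x => F x - F 0) GP (by simp) K hK0
  set w' : ℝ → ℝ := fun x => χ (x / K) * (F x - F 0) with hw'
  have hfP : PB β κ C' (fun x => v x - w' x) := by
    intro s t
    have a := hv s t
    have b := hcut s t
    have e : v t - w' t - (v s - w' s) = (v t - v s) - (w' t - w' s) := by ring
    show |v t - w' t - (v s - w' s)| ≤ _
    rw [e]
    refine (abs_sub _ _).trans ((add_le_add a b).trans (le_of_eq ?_))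
    rw [hC']; ring
  have hsmall : ∀ x, |x| ≤ K → |F x - v x| ≤ E := by
    intro x hx
    refine (Fv x).trans ?_
    rw [hE]; gcongr
  have hη : ∀ x, x ≤ 0 → |x| ≤ K → |v x - w' x| ≤ 2 * E := by
    intro x _ hx
    have c1 : χ (x / K) = 1 := χone _ (by rw [abs_div, abs_of_pos hK0, div_le_one hK0]; exact hx)
    have e : v x - w' x = (F 0 - v 0) - (F x - v x) := by
      simp only [hw', c1, hv0]; ring
    rw [e]
    refine (abs_sub _ _).trans ?_
    linarith [hsmall x hx, hsmall 0 (by simpa using hK0.le)]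
  refine ⟨w', ?_, ?_, by simp [hw'], ?_⟩
  · exact (χs.comp (contDiff_id.div_const K)).mul (Fs.sub contDiff_const)
  · apply HasCompactSupport.intro (K := Set.Icc (-(2 * K)) (2 * K)) isCompact_Icc
    intro x hx
    have : 2 * K ≤ |x| := by
      by_contra hh
      push Not at hh
      exact hx ⟨(abs_lt.1 hh).1.le, (abs_lt.1 hh).2.le⟩
    simp only [hw']
    rw [χzero _ (by rw [abs_div, abs_of_pos hK0, le_div_iff₀ hK0]; exact this), zero_mul]
  · refine lt_of_le_of_lt (Real.sSup_le ?_ (by positivity : 0 ≤ ε / 2)) (by linarith)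
    rintro q ⟨s, t, hs, ht, hst, rfl⟩
    have := quot_bound α g C' K (2 * E) (ε / 2) hα hg hCp hK1 _ hfP hη hK (by linarith) s t hs ht hst
    simpa [hvdef, min_eq_left hs, min_eq_left ht] using this
end

section
/- Let X and W be Polish spaces and let (Q_t)_{t≥0} be a Feller transition semigroup on X × W such that for every bounded continuous ψ and every z ∈ X × W the map t ↦ ∫ ψ d Q_t(z,·) is measurable. Let μ be a Borel probability measure on X × W such that for all t ≥ 0 the marginal of Q_t μ on X equals the marginal of μ on X, and the marginal of Q_t μ on W equals the marginal of μ on W. Then there exists a Borel probability measure μ⋆ on X × W which is invariant for (Q_t) (i.e. Q_t μ⋆ = μ⋆ for all t ≥ 0) and whose marginals on X and on W coincide with those of μ. (μ⋆ can be obtained as a weak limit point of the ergodic averages R_T μ = (1/T) ∫₀^T Q_t μ dt.) -/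
open MeasureTheory Set Filter Topology
open scoped NNReal ENNReal

lemma aux_integral_bind {A E : Type*} [MeasurableSpace A] [TopologicalSpace E]
    [PolishSpace E] [MeasurableSpace E] [BorelSpace E]
    (m : Measure A) [IsProbabilityMeasure m] (k : A → Measure E) (hk : Measurable k)
    (hp : ∀ a, IsProbabilityMeasure (k a)) (ψ : BoundedContinuousFunction E ℝ) :
    ∫ y, ψ y ∂(m.bind k) = ∫ a, ∫ y, ψ y ∂(k a) ∂m := by
  let K : ProbabilityTheory.Kernel A E := ⟨k, hk⟩
  have : ProbabilityTheory.IsMarkovKernel K := ⟨hp⟩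
  have hb : IsProbabilityMeasure (m.bind K) := inferInstance
  have h := ProbabilityTheory.Kernel.integral_comp (η := K)
    (κ := ProbabilityTheory.Kernel.const Unit m) (a := ()) (f := ψ) (ψ.integrable _)
  rw [ProbabilityTheory.Kernel.comp_apply, ProbabilityTheory.Kernel.const_apply] at h
  exact h

lemma aux_bind_prob {A E : Type*} [MeasurableSpace A] [MeasurableSpace E]
    (m : Measure A) [IsProbabilityMeasure m] (k : A → Measure E) (hk : Measurable k)
    (hp : ∀ a, IsProbabilityMeasure (k a)) : IsProbabilityMeasure (m.bind k) := by
  let K : ProbabilityTheory.Kernel A E := ⟨k, hk⟩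
  have : ProbabilityTheory.IsMarkovKernel K := ⟨hp⟩
  exact (inferInstance : IsProbabilityMeasure (m.bind K))

lemma aux_map_bind {A E F : Type*} [MeasurableSpace A] [MeasurableSpace E] [MeasurableSpace F]
    (m : Measure A) [IsProbabilityMeasure m] (k : A → Measure E) (hk : Measurable k)
    (g : E → F) (hg : Measurable g) (ν : Measure F) (h : ∀ a, (k a).map g = ν) :
    (m.bind k).map g = ν := by
  ext s hs
  rw [Measure.map_apply hg hs, Measure.bind_apply (hg hs) hk.aemeasurable]
  have : ∀ a, k a (g ⁻¹' s) = ν s := fun a => by rw [← h a, Measure.map_apply hg hs]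
  simp [this]

lemma aux_measurable {A E : Type*} [MeasurableSpace A] [TopologicalSpace E]
    [PolishSpace E] [MeasurableSpace E] [BorelSpace E]
    (k : A → Measure E) (hp : ∀ a, IsProbabilityMeasure (k a))
    (h : ∀ ψ : BoundedContinuousFunction E ℝ, Measurable fun a => ∫ y, ψ y ∂(k a)) :
    Measurable k := by
  let := TopologicalSpace.upgradeIsCompletelyMetrizable E
  refine Measurable.measure_of_isPiSystem_of_isProbabilityMeasure (S := {s | IsClosed s})
    (by rw [BorelSpace.measurable_eq (α := E), borel_eq_generateFrom_isClosed])
    isPiSystem_isClosed ?_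
  intro F hF
  have hF : IsClosed F := hF
  refine measurable_of_tendsto_metrizable (f := fun n a => ∫⁻ x, hF.apprSeq n x ∂(k a)) ?_
    (tendsto_pi_nhds.2 fun a => HasOuterApproxClosed.tendsto_lintegral_apprSeq hF (k a))
  intro n
  let ψ : BoundedContinuousFunction E ℝ := BoundedContinuousFunction.ofNormedAddCommGroup
    (fun x => (hF.apprSeq n x : ℝ)) (by fun_prop) 1
    (fun x => by simpa using (HasOuterApproxClosed.apprSeq_apply_le_one hF n x))
  have := (h ψ).ennreal_ofReal
  convert this using 2 with a
  rw [ofReal_integral_eq_lintegral_ofReal (ψ.integrable _) (ae_of_all _ fun x => by simp [ψ])]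
  simp [ψ]

lemma aux_avg (f : ℝ → ℝ) (hf : Measurable f) (C : ℝ) (hC : ∀ t, |f t| ≤ C) (s : ℝ)
    (n : ℝ) :
    |(∫ t in (0:ℝ)..n, f (t + s)) - ∫ t in (0:ℝ)..n, f t| ≤ 2 * C * |s| := by
  have hi : ∀ a b, IntervalIntegrable f volume a b := fun a b =>
    (intervalIntegrable_const (c := C)).mono_fun hf.aestronglyMeasurable
      (ae_of_all _ fun t => by simpa using (hC t).trans (le_abs_self C))
  rw [intervalIntegral.integral_comp_add_right,
    intervalIntegral.integral_interval_sub_interval_comm (hi _ _) (hi _ _) (hi _ _)]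
  have h1 := intervalIntegral.norm_integral_le_of_norm_le_const (f := f) (a := 0 + s) (b := 0)
    (C := C) (fun t _ => hC t)
  have h2 := intervalIntegral.norm_integral_le_of_norm_le_const (f := f) (a := n + s) (b := n)
    (C := C) (fun t _ => hC t)
  simp only [Real.norm_eq_abs] at h1 h2
  simp at h1 h2 ⊢
  refine (abs_sub _ _).trans ?_
  linarith

theorem stmt7 {X W : Type*}
    [TopologicalSpace X] [PolishSpace X] [MeasurableSpace X] [BorelSpace X]
    [TopologicalSpace W] [PolishSpace W] [MeasurableSpace W] [BorelSpace W]
    (Q : ℝ≥0 → X × W → Measure (X × W))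
    (hQmeas : ∀ t, Measurable (Q t))
    (hQprob : ∀ t z, IsProbabilityMeasure (Q t z))
    (hQ0 : ∀ z, Q 0 z = Measure.dirac z)
    (hQsemi : ∀ s t : ℝ≥0, ∀ z, Q (s + t) z = (Q t z).bind (Q s))
    (hQFeller : ∀ (t : ℝ≥0) (ψ : BoundedContinuousFunction (X × W) ℝ),
      Continuous fun z => ∫ y, ψ y ∂(Q t z))
    (hQtime : ∀ (ψ : BoundedContinuousFunction (X × W) ℝ) (z : X × W),
      Measurable fun t : ℝ≥0 => ∫ y, ψ y ∂(Q t z))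
    (μ : Measure (X × W)) (hμ : IsProbabilityMeasure μ)
    (hμX : ∀ t, (μ.bind (Q t)).map Prod.fst = μ.map Prod.fst)
    (hμW : ∀ t, (μ.bind (Q t)).map Prod.snd = μ.map Prod.snd) :
    ∃ μs : Measure (X × W), IsProbabilityMeasure μs ∧
      (∀ t, μs.bind (Q t) = μs) ∧
      μs.map Prod.fst = μ.map Prod.fst ∧
      μs.map Prod.snd = μ.map Prod.snd := by
  -- the flow of measures
  let κ : ℝ → Measure (X × W) := fun t => μ.bind (Q t.toNNReal)
  have hκp : ∀ t, IsProbabilityMeasure (κ t) := fun t =>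
    aux_bind_prob μ _ (hQmeas _) (hQprob _)
  have hκi : ∀ (ψ : BoundedContinuousFunction (X × W) ℝ) t,
      ∫ y, ψ y ∂(κ t) = ∫ z, ∫ y, ψ y ∂(Q t.toNNReal z) ∂μ := fun ψ t =>
    aux_integral_bind μ _ (hQmeas _) (hQprob _) ψ
  have hκψ : ∀ ψ : BoundedContinuousFunction (X × W) ℝ,
      Measurable fun t => ∫ y, ψ y ∂(κ t) := by
    intro ψ
    simp_rw [hκi]
    have h1 : Measurable (Function.uncurry fun (z : X × W) (t : ℝ≥0) => ∫ y, ψ y ∂(Q t z)) :=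
      measurable_uncurry_of_continuous_of_measurable (fun t => hQFeller t ψ) (fun z => hQtime ψ z)
    have h2 : Measurable (fun t : ℝ≥0 => ∫ z, ∫ y, ψ y ∂(Q t z) ∂μ) :=
      (h1.stronglyMeasurable.integral_prod_left (μ := μ)).measurable
    exact h2.comp measurable_real_toNNReal
  have hκm : Measurable κ := aux_measurable κ hκp hκψ
  -- the uniform measures
  let U : ℕ → Measure ℝ := fun n =>
    (ENNReal.ofReal ((n : ℝ) + 1))⁻¹ • (volume.restrict (Ioc (0 : ℝ) (n + 1)))
  have hU : ∀ n, IsProbabilityMeasure (U n) := by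
    intro n
    constructor
    simp only [U, Measure.smul_apply, Measure.restrict_apply_univ, Real.volume_Ioc, sub_zero,
      smul_eq_mul]
    exact ENNReal.inv_mul_cancel (by simp; positivity) (by simp)
  have hUi : ∀ n (f : ℝ → ℝ), ∫ t, f t ∂(U n) = ((n : ℝ) + 1)⁻¹ * ∫ t in (0:ℝ)..(n+1), f t := by
    intro n f
    have h0 : (0 : ℝ) ≤ (n : ℝ) + 1 := by positivity
    simp only [U]
    rw [integral_smul_measure, intervalIntegral.integral_of_le h0, ENNReal.toReal_inv,
      ENNReal.toReal_ofReal h0, smul_eq_mul]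
  let R : ℕ → Measure (X × W) := fun n => (U n).bind κ
  have hRp : ∀ n, IsProbabilityMeasure (R n) := fun n => aux_bind_prob _ _ hκm hκp
  have hR1 : ∀ n, (R n).map Prod.fst = μ.map Prod.fst := fun n =>
    aux_map_bind _ _ hκm _ measurable_fst _ (fun t => hμX _)
  have hR2 : ∀ n, (R n).map Prod.snd = μ.map Prod.snd := fun n =>
    aux_map_bind _ _ hκm _ measurable_snd _ (fun t => hμW _)
  -- compactness
  let P : ℕ → ProbabilityMeasure (X × W) := fun n => ⟨R n, hRp n⟩
  have htight : IsTightMeasureSet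
      {((ν : ProbabilityMeasure (X × W)) : Measure (X × W)) | ν ∈ range P} := by
    have : IsProbabilityMeasure (μ.map Prod.fst) :=
      Measure.isProbabilityMeasure_map measurable_fst.aemeasurable
    have : IsProbabilityMeasure (μ.map Prod.snd) :=
      Measure.isProbabilityMeasure_map measurable_snd.aemeasurable
    refine IsTightMeasureSet.prodMk
      ((isTightMeasureSet_singleton (μ := μ.map Prod.fst)).subset ?_)
      ((isTightMeasureSet_singleton (μ := μ.map Prod.snd)).subset ?_)
    · rintro _ ⟨_, ⟨_, ⟨n, rfl⟩, rfl⟩, rfl⟩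
      exact hR1 n
    · rintro _ ⟨_, ⟨_, ⟨n, rfl⟩, rfl⟩, rfl⟩
      exact hR2 n
  have hcpt := isCompact_closure_of_isTightMeasureSet htight
  let F : Ultrafilter ℕ := Filter.hyperfilter ℕ
  have hF : (F : Filter ℕ) ≤ atTop := Nat.hyperfilter_le_atTop
  obtain ⟨ν, -, hν⟩ := hcpt.ultrafilter_le_nhds (F.map P) (by
    rw [le_principal_iff]
    exact Filter.mem_map.2 (Filter.univ_mem' fun n => subset_closure (mem_range_self n)))
  have hlim : Tendsto P F (𝓝 ν) := hν
  have hlimi := ProbabilityMeasure.tendsto_iff_forall_integral_tendsto.1 hlim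
  refine ⟨ν, inferInstance, ?_, ?_, ?_⟩
  · intro s
    have := aux_bind_prob (ν : Measure (X × W)) _ (hQmeas s) (hQprob s)
    refine ext_of_forall_integral_eq_of_IsFiniteMeasure fun ψ => ?_
    rw [aux_integral_bind _ _ (hQmeas s) (hQprob s)]
    let φ : BoundedContinuousFunction (X × W) ℝ :=
      BoundedContinuousFunction.ofNormedAddCommGroup (fun z => ∫ y, ψ y ∂(Q s z))
        (hQFeller s ψ) ‖ψ‖ (fun z => by
          have := hQprob s z
          exact ψ.norm_integral_le_norm _)
    have hdiff := (hlimi φ).sub (hlimi ψ)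
    have hzero : Tendsto (fun n => ∫ y, φ y ∂(P n : Measure (X × W))
        - ∫ y, ψ y ∂(P n : Measure (X × W))) F (𝓝 0) := by
      refine Tendsto.mono_left ?_ hF
      have hb : ∀ n : ℕ, ‖∫ y, φ y ∂(P n : Measure (X × W))
          - ∫ y, ψ y ∂(P n : Measure (X × W))‖ ≤ (2 * ‖ψ‖ * |(s : ℝ)|) * (1 / ((n : ℝ) + 1)) := by
        intro n
        have e1 : ∫ y, ψ y ∂(P n : Measure (X × W))
            = ((n : ℝ) + 1)⁻¹ * ∫ t in (0:ℝ)..(n+1), ∫ y, ψ y ∂(κ t) := by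
          rw [← hUi]; exact aux_integral_bind _ _ hκm hκp ψ
        have e2 : ∫ y, φ y ∂(P n : Measure (X × W))
            = ((n : ℝ) + 1)⁻¹ * ∫ t in (0:ℝ)..(n+1), ∫ y, ψ y ∂(κ (t + s)) := by
          have : ∫ y, φ y ∂(P n : Measure (X × W))
            = ((n : ℝ) + 1)⁻¹ * ∫ t in (0:ℝ)..(n+1), ∫ y, φ y ∂(κ t) := by
            rw [← hUi]; exact aux_integral_bind _ _ hκm hκp φ
          rw [this]
          congr 1
          refine intervalIntegral.integral_congr fun t ht => ?_
          have ht0 : 0 ≤ t := by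
            rw [uIcc_of_le (by positivity)] at ht; exact ht.1
          have hk : κ (t + s) = (κ t).bind (Q s) := by
            simp only [κ]
            rw [Measure.bind_bind (hQmeas _).aemeasurable (hQmeas _).aemeasurable]
            congr 1
            funext z
            rw [← hQsemi, Real.toNNReal_add ht0 s.coe_nonneg, Real.toNNReal_coe, add_comm]
          simp only [hk]
          rw [aux_integral_bind _ _ (hQmeas s) (hQprob s)]
          rfl
        have h := aux_avg (fun t => ∫ y, ψ y ∂(κ t)) (hκψ ψ) ‖ψ‖
          (fun t => ψ.norm_integral_le_norm _) s (n + 1)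
        have hn : (0 : ℝ) ≤ ((n : ℝ) + 1)⁻¹ := by positivity
        rw [e1, e2, ← mul_sub, norm_mul, Real.norm_eq_abs, Real.norm_eq_abs, abs_of_nonneg hn,
          one_div, mul_comm]
        exact mul_le_mul_of_nonneg_right h hn
      refine squeeze_zero_norm hb ?_
      simpa using (tendsto_one_div_add_atTop_nhds_zero_nat (𝕜 := ℝ)).const_mul
        (2 * ‖ψ‖ * |(s : ℝ)|)
    exact sub_eq_zero.1 (tendsto_nhds_unique hdiff hzero)
  · have h := ProbabilityMeasure.tendsto_map_of_tendsto_of_continuous P ν hlim continuous_fst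
    have hc : ∀ n, (P n).map (continuous_fst (X := X) (Y := W)).measurable.aemeasurable =
        (P 0).map (continuous_fst (X := X) (Y := W)).measurable.aemeasurable := fun n =>
      Subtype.ext ((hR1 n).trans (hR1 0).symm)
    simp only [hc] at h
    have := tendsto_nhds_unique h tendsto_const_nhds
    exact (congrArg Subtype.val this).trans (hR1 0)
  · have h := ProbabilityMeasure.tendsto_map_of_tendsto_of_continuous P ν hlim continuous_snd
    have hc : ∀ n, (P n).map (continuous_snd (X := X) (Y := W)).measurable.aemeasurable =
        (P 0).map (continuous_snd (X := X) (Y := W)).measurable.aemeasurable := fun n =>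
      Subtype.ext ((hR2 n).trans (hR2 0).symm)
    simp only [hc] at h
    have := tendsto_nhds_unique h tendsto_const_nhds
    exact (congrArg Subtype.val this).trans (hR2 0)
end

section
/- Let H ∈ (1/2, 1), α ∈ (0, H), and let α_H be a fixed nonzero constant. Then there exists a constant C > 0, depending only on H, α and α_H, with the following property. Let g_B : [0,1] → ℝⁿ be absolutely continuous with derivative g_B′ ∈ L¹([0,1]), and set ‖g_B‖_{1,1} = ∫₀¹ ‖g_B′(s)‖ ds + ‖g_B(0)‖. Define g_w : (0,∞) → ℝⁿ by g_w(t) = α_H [ g_B(0) t^{1/2−H} + ∫₀^t (t − s)^{1/2−H} g_B′(s) ds ] for 0 < t ≤ 1, and g_w(t) = α_H (1/2 − H) ∫₀^1 (t − s)^{−1/2−H} g_B(s) ds for t > 1. Then ‖g_w‖_α ≤ C ‖g_B‖_{1,1}. -/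
open MeasureTheory Set
open scoped ENNReal

/-- The squared weighted norm `‖g‖_α² = ∫₀^∞ (1+t)^{2α} ‖g(t)‖² dt`, as an extended
nonnegative real. -/
noncomputable def alphaNormSq {E : Type*} [NormedAddCommGroup E] (α : ℝ) (g : ℝ → E) :
    ℝ≥0∞ :=
  ∫⁻ t in Set.Ioi (0 : ℝ), ENNReal.ofReal ((1 + t) ^ (2 * α) * ‖g t‖ ^ 2)


noncomputable def kerK (b : ℝ) (u : ℝ) : ℝ≥0∞ :=
  (Set.Ioi (0 : ℝ)).indicator (fun u => ENNReal.ofReal (u ^ b)) u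

lemma kerK_meas (b : ℝ) : Measurable (kerK b) := by
  unfold kerK
  apply Measurable.indicator _ measurableSet_Ioi
  fun_prop

lemma kerK_sq (b u : ℝ) : kerK b u ^ 2 = kerK (2 * b) u := by
  unfold kerK
  by_cases h : 0 < u
  · rw [Set.indicator_of_mem (show u ∈ Ioi (0:ℝ) from h),
      Set.indicator_of_mem (show u ∈ Ioi (0:ℝ) from h), ← ENNReal.ofReal_pow (by positivity),
      ← Real.rpow_natCast, ← Real.rpow_mul h.le]
    congr 2
    push_cast; ring
  · rw [Set.indicator_of_notMem (by simpa using h), Set.indicator_of_notMem (by simpa using h)]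
    simp

lemma cs_sq {μ : Measure ℝ} {f : ℝ → ℝ≥0∞} (hf : Measurable f) :
    (∫⁻ s, f s ∂μ) ^ 2 ≤ μ univ * ∫⁻ s, f s ^ 2 ∂μ := by
  have h := ENNReal.lintegral_mul_le_Lp_mul_Lq μ Real.HolderConjugate.two_two
    hf.aemeasurable (aemeasurable_const (b := (1 : ℝ≥0∞)))
  simp only [Pi.mul_apply, mul_one, ENNReal.one_rpow, lintegral_const, one_mul] at h
  calc _ ≤ _ := pow_le_pow_left' h 2
    _ = _ := by
      rw [mul_pow, ← ENNReal.rpow_natCast, ← ENNReal.rpow_natCast, ← ENNReal.rpow_mul,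
        ← ENNReal.rpow_mul]
      norm_num
      rw [mul_comm]

noncomputable def muM {n : ℕ} (x : EuclideanSpace ℝ (Fin n)) (g : ℝ → EuclideanSpace ℝ (Fin n)) :
    Measure ℝ :=
  ‖x‖ₑ • Measure.dirac 0 + (volume.restrict (Ioc (0:ℝ) 1)).withDensity (fun s => ‖g s‖ₑ)

lemma muM_lint {n : ℕ} (x : EuclideanSpace ℝ (Fin n)) (g : ℝ → EuclideanSpace ℝ (Fin n))
    (hg : IntegrableOn g (Ioc 0 1)) {f : ℝ → ℝ≥0∞} (hf : Measurable f) :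
    ∫⁻ s, f s ∂(muM x g) = ‖x‖ₑ * f 0 + ∫⁻ s in Ioc (0:ℝ) 1, ‖g s‖ₑ * f s := by
  unfold muM
  rw [lintegral_add_measure, lintegral_smul_measure, lintegral_dirac,
    lintegral_withDensity_eq_lintegral_mul₀ hg.1.enorm hf.aemeasurable]
  rfl

lemma muM_univ {n : ℕ} (x : EuclideanSpace ℝ (Fin n)) (g : ℝ → EuclideanSpace ℝ (Fin n))
    (hg : IntegrableOn g (Ioc 0 1)) :
    muM x g univ = ENNReal.ofReal ((∫ s in (0 : ℝ)..(1 : ℝ), ‖g s‖) + ‖x‖) := by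
  have h := muM_lint x g hg (f := fun _ => 1) measurable_const
  simp only [lintegral_const, one_mul, mul_one] at h
  rw [h, intervalIntegral.integral_of_le zero_le_one, ENNReal.ofReal_add
    (integral_nonneg fun _ => norm_nonneg _) (norm_nonneg _), ofReal_integral_norm_eq_lintegral_enorm hg,
    ofReal_norm, add_comm]

lemma ptA {n : ℕ} (x : EuclideanSpace ℝ (Fin n)) (g : ℝ → EuclideanSpace ℝ (Fin n))
    (hg : IntegrableOn g (Ioc 0 1)) (b : ℝ) (hb : b ≠ 0) (t : ℝ) (ht : t ∈ Ioc (0:ℝ) 1) :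
    ‖(t ^ b) • x + ∫ s in (0 : ℝ)..t, ((t - s) ^ b) • g s‖ₑ ≤ ∫⁻ s, kerK b (t - s) ∂(muM x g) := by
  rw [muM_lint x g hg (f := fun s => kerK b (t - s))
    ((kerK_meas b).comp (measurable_const.sub measurable_id))]
  refine (enorm_add_le _ _).trans (add_le_add ?_ ?_)
  · rw [enorm_smul, mul_comm]
    gcongr
    simp only [sub_zero, kerK]
    rw [Set.indicator_of_mem (show t ∈ Ioi (0:ℝ) from ht.1), Real.enorm_eq_ofReal
      (Real.rpow_nonneg ht.1.le _)]
  · rw [intervalIntegral.integral_of_le ht.1.le]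
    refine (enorm_integral_le_lintegral_enorm _).trans ?_
    refine le_trans ?_ (lintegral_mono_set (Ioc_subset_Ioc_right ht.2))
    refine setLIntegral_mono' measurableSet_Ioc fun s hs => ?_
    rw [enorm_smul, mul_comm]
    gcongr
    rcases hs.2.eq_or_lt with h | h
    · simp [h, Real.zero_rpow hb]
    · have : 0 < t - s := sub_pos.2 h
      rw [kerK, Set.indicator_of_mem (show t - s ∈ Ioi (0:ℝ) from this), Real.enorm_eq_ofReal
        (Real.rpow_nonneg this.le _)]

lemma intA {n : ℕ} (x : EuclideanSpace ℝ (Fin n)) (g : ℝ → EuclideanSpace ℝ (Fin n))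
    (hg : IntegrableOn g (Ioc 0 1)) (b : ℝ) (hb : b ≠ 0) :
    ∫⁻ t in Ioc (0:ℝ) 1, ‖(t ^ b) • x + ∫ s in (0 : ℝ)..t, ((t - s) ^ b) • g s‖ₑ ^ 2 ≤
      (muM x g univ) ^ 2 * ∫⁻ u in Ioc (0:ℝ) 1, ENNReal.ofReal (u ^ (2 * b)) := by
  have hfin : IsFiniteMeasure (muM x g) := ⟨by rw [muM_univ x g hg]; exact ENNReal.ofReal_lt_top⟩
  have hm2 : Measurable (fun p : ℝ × ℝ => kerK (2 * b) (p.1 - p.2)) :=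
    (kerK_meas _).comp (measurable_fst.sub measurable_snd)
  calc _ ≤ ∫⁻ t in Ioc (0:ℝ) 1, muM x g univ * ∫⁻ s, kerK (2 * b) (t - s) ∂(muM x g) := by
        refine setLIntegral_mono' measurableSet_Ioc fun t ht => ?_
        refine (pow_le_pow_left' (ptA x g hg b hb t ht) 2).trans ?_
        refine (cs_sq ((kerK_meas b).comp (measurable_const.sub measurable_id))).trans ?_
        simp only [Function.comp_def, kerK_sq]
        rfl
    _ = muM x g univ * ∫⁻ t in Ioc (0:ℝ) 1, ∫⁻ s, kerK (2 * b) (t - s) ∂(muM x g) := by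
        rw [lintegral_const_mul' _ _ (measure_ne_top _ _)]
    _ = muM x g univ * ∫⁻ s, ∫⁻ t in Ioc (0:ℝ) 1, kerK (2 * b) (t - s) ∂volume ∂(muM x g) := by
        rw [lintegral_lintegral_swap]
        exact hm2.aemeasurable
    _ ≤ muM x g univ * ∫⁻ s, (∫⁻ u in Ioc (0:ℝ) 1, ENNReal.ofReal (u ^ (2 * b))) ∂(muM x g) := by
        refine mul_le_mul_right (lintegral_mono_ae ?_) _
        have hae : ∀ᵐ s ∂(muM x g), 0 ≤ s := by
          unfold muM
          rw [ae_add_measure_iff]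
          constructor
          · refine Measure.ae_smul_measure ?_ _
            rw [ae_dirac_iff measurableSet_Ici]
          · refine (withDensity_absolutelyContinuous _ _).ae_le ?_
            filter_upwards [ae_restrict_mem measurableSet_Ioc] with s hs using hs.1.le
        filter_upwards [hae] with s hs
        rw [← lintegral_indicator measurableSet_Ioc, ← lintegral_indicator measurableSet_Ioc,
          ← lintegral_sub_right_eq_self ((Ioc (0:ℝ) 1).indicator
            fun u => ENNReal.ofReal (u ^ (2 * b))) s]
        refine lintegral_mono fun t => ?_
        by_cases h1 : t ∈ Ioc (0:ℝ) 1
        · rw [Set.indicator_of_mem h1, kerK]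
          by_cases h2 : 0 < t - s
          · rw [Set.indicator_of_mem (show t - s ∈ Ioi (0:ℝ) from h2),
              Set.indicator_of_mem (show t - s ∈ Ioc (0:ℝ) 1 from ⟨h2, by linarith [h1.2]⟩)]
          · rw [Set.indicator_of_notMem (by simpa using h2)]
            exact zero_le
        · rw [Set.indicator_of_notMem h1]
          exact zero_le
    _ = _ := by
        rw [lintegral_const]; ring

lemma gB_bound {n : ℕ} (gB g : ℝ → EuclideanSpace ℝ (Fin n)) (hg : IntegrableOn g (Ioc 0 1))
    (h : ∀ t ∈ Set.Icc (0 : ℝ) 1, gB t = gB 0 + ∫ s in (0 : ℝ)..t, g s) (t : ℝ)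
    (ht : t ∈ Icc (0:ℝ) 1) :
    ‖gB t‖ ≤ (∫ s in (0 : ℝ)..(1 : ℝ), ‖g s‖) + ‖gB 0‖ := by
  rw [h t ht, add_comm]
  refine (norm_add_le _ _).trans ?_
  gcongr
  rw [intervalIntegral.integral_of_le ht.1, intervalIntegral.integral_of_le zero_le_one]
  refine (norm_integral_le_integral_norm _).trans ?_
  exact setIntegral_mono_set hg.norm (ae_of_all _ fun _ => norm_nonneg _)
    (Ioc_subset_Ioc_right ht.2).eventuallyLE

lemma ptB {n : ℕ} (gB : ℝ → EuclideanSpace ℝ (Fin n)) (N : ℝ)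
    (hN : ∀ t ∈ Icc (0:ℝ) 1, ‖gB t‖ ≤ N) (b : ℝ) (hb : b < 0) (t : ℝ) (ht : 1 < t) :
    ‖∫ s in (0 : ℝ)..(1 : ℝ), ((t - s) ^ (b - 1)) • gB s‖ ≤ (t - 1) ^ b / (-b) * N ∧
    ‖∫ s in (0 : ℝ)..(1 : ℝ), ((t - s) ^ (b - 1)) • gB s‖ ≤ (t - 1) ^ (b - 1) * N := by
  have hN0 : 0 ≤ N := (norm_nonneg _).trans (hN 0 (by simp))
  constructor
  · have hc : ContinuousOn (fun s : ℝ => (t - s) ^ (b - 1) * N) (uIcc 0 1) := by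
      rw [uIcc_of_le zero_le_one]
      refine ContinuousOn.mul (ContinuousOn.rpow_const (by fun_prop) ?_) continuousOn_const
      intro s hs
      left
      linarith [hs.2]
    have h1 : ‖∫ s in (0 : ℝ)..(1 : ℝ), ((t - s) ^ (b - 1)) • gB s‖ ≤
        ∫ s in (0:ℝ)..1, (t - s) ^ (b - 1) * N := by
      refine intervalIntegral.norm_integral_le_of_norm_le zero_le_one ?_ hc.intervalIntegrable
      refine ae_of_all _ fun s hs => ?_
      have : 0 < t - s := by linarith [hs.2]
      rw [norm_smul, Real.norm_of_nonneg (by positivity)]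
      gcongr
      exact hN s ⟨hs.1.le, hs.2⟩
    refine h1.trans ?_
    rw [intervalIntegral.integral_mul_const]
    gcongr
    rw [intervalIntegral.integral_comp_sub_left (fun s => s ^ (b - 1)) t, integral_rpow]
    · rw [sub_add_cancel, sub_zero, ← neg_div_neg_eq]
      have : 0 < t ^ b := Real.rpow_pos_of_pos (by linarith) _
      gcongr
      · linarith
      · linarith
    · right
      refine ⟨by linarith, ?_⟩
      rw [uIcc_of_le (by linarith)]
      intro h
      linarith [h.1]
  · have := intervalIntegral.norm_integral_le_of_norm_le_const (a := (0:ℝ)) (b := 1)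
      (f := fun s => ((t - s) ^ (b - 1)) • gB s) (C := (t - 1) ^ (b - 1) * N) ?_
    · simpa using this
    · intro s hs
      rw [uIoc_of_le zero_le_one] at hs
      have : 0 < t - s := by linarith [hs.2]
      rw [norm_smul, Real.norm_of_nonneg (by positivity)]
      have h2 := hN s ⟨hs.1.le, hs.2⟩
      have h3 : (t - s) ^ (b - 1) ≤ (t - 1) ^ (b - 1) :=
        Real.rpow_le_rpow_of_nonpos (by linarith) (by linarith [hs.2]) (by linarith)
      gcongr

noncomputable def kerF (α b u : ℝ) : ℝ≥0∞ :=
  (Ioc (0:ℝ) 1).indicator (fun u => ENNReal.ofReal (u ^ (2 * b))) u +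
  (Ioi (1:ℝ)).indicator (fun u => ENNReal.ofReal (u ^ (2 * α + 2 * b - 2))) u

lemma kerF_fin (α b : ℝ) (hb : -(1/2) < b) (hab : α + b < 1/2) : ∫⁻ u, kerF α b u < ∞ := by
  unfold kerF
  rw [lintegral_add_left (Measurable.indicator (by fun_prop) measurableSet_Ioc),
    lintegral_indicator measurableSet_Ioc, lintegral_indicator measurableSet_Ioi]
  refine ENNReal.add_lt_top.2 ⟨?_, ?_⟩
  · have := intervalIntegral.intervalIntegrable_rpow' (a := 0) (b := 1) (r := 2 * b) (by linarith)
    rw [intervalIntegrable_iff_integrableOn_Ioc_of_le zero_le_one] at this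
    exact this.lintegral_lt_top
  · exact (integrableOn_Ioi_rpow_of_lt (a := 2 * α + 2 * b - 2) (by linarith) 
      zero_lt_one).lintegral_lt_top

lemma intB {n : ℕ} (gB : ℝ → EuclideanSpace ℝ (Fin n)) (N : ℝ)
    (hN : ∀ t ∈ Icc (0:ℝ) 1, ‖gB t‖ ≤ N) (α b : ℝ) (hα : 0 < α) (hb : b < 0) :
    ∫⁻ t in Ioi (1:ℝ), ENNReal.ofReal ((1 + t) ^ (2 * α) *
      ‖∫ s in (0 : ℝ)..(1 : ℝ), ((t - s) ^ (b - 1)) • gB s‖ ^ 2) ≤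
    ENNReal.ofReal (3 ^ (2 * α) * (1 / b ^ 2 + 1)) * ENNReal.ofReal N ^ 2 * ∫⁻ u, kerF α b u := by
  have hN0 : 0 ≤ N := (norm_nonneg _).trans (hN 0 (by simp))
  rw [← lintegral_sub_right_eq_self (kerF α b) 1, ← lintegral_const_mul' _ _ (by finiteness),
    ← lintegral_indicator measurableSet_Ioi]
  refine lintegral_mono fun t => ?_
  by_cases ht : 1 < t
  swap
  · rw [Set.indicator_of_notMem (by simpa using ht)]
    exact zero_le
  rw [Set.indicator_of_mem (show t ∈ Ioi (1:ℝ) from ht)]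
  obtain ⟨h1, h2⟩ := ptB gB N hN b hb t ht
  have hu : 0 < t - 1 := by linarith
  rw [← ENNReal.ofReal_pow hN0, ← ENNReal.ofReal_mul (by positivity), kerF]
  by_cases h : t - 1 ≤ 1
  · rw [Set.indicator_of_mem (show t - 1 ∈ Ioc (0:ℝ) 1 from ⟨hu, h⟩), Set.indicator_of_notMem (by simpa using h), add_zero,
      ← ENNReal.ofReal_mul (by positivity)]
    apply ENNReal.ofReal_le_ofReal
    calc _ ≤ 3 ^ (2 * α) * ((t - 1) ^ b / (-b) * N) ^ 2 := by
          gcongr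
          linarith
      _ = 3 ^ (2 * α) * (1 / b ^ 2) * N ^ 2 * (t - 1) ^ (2 * b) := by
          rw [mul_comm 2 b, Real.rpow_mul hu.le b 2, Real.rpow_two]
          have := hb.ne
          field_simp
      _ ≤ _ := by
          gcongr
          linarith
  · rw [Set.indicator_of_notMem (fun hh => h hh.2), Set.indicator_of_mem (show t - 1 ∈ Ioi (1:ℝ) from not_le.1 h),
      zero_add, ← ENNReal.ofReal_mul (by positivity)]
    apply ENNReal.ofReal_le_ofReal
    calc _ ≤ (3 * (t - 1)) ^ (2 * α) * ((t - 1) ^ (b - 1) * N) ^ 2 := by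
          gcongr
          linarith
      _ = 3 ^ (2 * α) * 1 * N ^ 2 * (t - 1) ^ (2 * α + 2 * b - 2) := by
          rw [show 2 * α + 2 * b - 2 = 2 * α + (b - 1) * 2 by ring, Real.rpow_add hu, 
            Real.rpow_mul hu.le (b-1) 2, Real.rpow_two, Real.mul_rpow (by norm_num) hu.le]
          ring
      _ ≤ _ := by
          gcongr
          have : 0 ≤ 1 / b ^ 2 := by positivity
          linarith

/-- Lemma 5.1 (case `H > 1/2`): for absolutely continuous `g_B : [0,1] → ℝⁿ` with
`W^{1,1}`-norm `∫₀¹ ‖g_B'‖ + ‖g_B(0)‖`, the function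
`g_w(t) = α_H [g_B(0) t^{1/2-H} + ∫₀^t (t-s)^{1/2-H} g_B'(s) ds]` for `t ≤ 1` and
`g_w(t) = α_H (1/2-H) ∫₀¹ (t-s)^{-1/2-H} g_B(s) ds` for `t > 1` satisfies
`‖g_w‖_α ≤ C ‖g_B‖_{1,1}`, with `C` depending only on `H`, `α`, `α_H`. -/
theorem stmt13 (n : ℕ) (H α αH : ℝ) (hH : H ∈ Set.Ioo ((1 : ℝ) / 2) 1)
    (hα : α ∈ Set.Ioo (0 : ℝ) H) (hαH : αH ≠ 0) :
    ∃ C : ℝ, 0 < C ∧ ∀ gB gB' : ℝ → EuclideanSpace ℝ (Fin n),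
      IntegrableOn gB' (Set.Icc 0 1) →
      (∀ t ∈ Set.Icc (0 : ℝ) 1, gB t = gB 0 + ∫ s in (0 : ℝ)..t, gB' s) →
      (alphaNormSq α fun t : ℝ =>
          if t ≤ 1 then
            αH • ((t ^ ((1 : ℝ) / 2 - H)) • gB 0 +
              ∫ s in (0 : ℝ)..t, ((t - s) ^ ((1 : ℝ) / 2 - H)) • gB' s)
          else
            (αH * ((1 : ℝ) / 2 - H)) •
              ∫ s in (0 : ℝ)..(1 : ℝ), ((t - s) ^ (-(1 : ℝ) / 2 - H)) • gB s) ^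
          ((1 : ℝ) / 2) ≤
        ENNReal.ofReal (C * ((∫ s in (0 : ℝ)..(1 : ℝ), ‖gB' s‖) + ‖gB 0‖)) := by
  obtain ⟨hH1, hH2⟩ := hH
  obtain ⟨hα0, hα1⟩ := hα
  set b : ℝ := 1 / 2 - H with hbdef
  have hb : b < 0 := by linarith
  have hexp : -(1:ℝ) / 2 - H = b - 1 := by rw [hbdef]; ring
  have hF := kerF_fin α b (by linarith) (by linarith)
  have hA : ∫⁻ u in Ioc (0:ℝ) 1, ENNReal.ofReal (u ^ (2 * b)) < ∞ := by
    have := intervalIntegral.intervalIntegrable_rpow' (a := 0) (b := 1) (r := 2 * b) (by linarith)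
    rw [intervalIntegrable_iff_integrableOn_Ioc_of_le zero_le_one] at this
    exact this.lintegral_lt_top
  set A := ∫⁻ u in Ioc (0:ℝ) 1, ENNReal.ofReal (u ^ (2 * b))
  set F := ∫⁻ u, kerF α b u
  set M : ℝ≥0∞ := ENNReal.ofReal (2 ^ (2 * α) * αH ^ 2) * A +
    ENNReal.ofReal ((αH * b) ^ 2) * (ENNReal.ofReal (3 ^ (2 * α) * (1 / b ^ 2 + 1)) * F) with hM
  have hMfin : M ≠ ∞ := by
    have := hA.ne
    have := hF.ne
    finiteness
  have hM2 : M ^ ((1:ℝ) / 2) ≠ ∞ := by finiteness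
  refine ⟨(M ^ ((1:ℝ) / 2)).toReal + 1, by positivity, ?_⟩
  intro gB gB' hint hgB
  have hg : IntegrableOn gB' (Ioc 0 1) := hint.mono_set Ioc_subset_Icc_self
  have hbd := gB_bound gB gB' hg hgB
  have hmu := muM_univ (gB 0) gB' hg
  set N := (∫ s in (0 : ℝ)..(1 : ℝ), ‖gB' s‖) + ‖gB 0‖
  have hN0 : 0 ≤ N := (norm_nonneg _).trans (hbd 0 (by simp))
  have key : (alphaNormSq α fun t : ℝ =>
          if t ≤ 1 then
            αH • ((t ^ b) • gB 0 +
              ∫ s in (0 : ℝ)..t, ((t - s) ^ b) • gB' s)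
          else
            (αH * b) •
              ∫ s in (0 : ℝ)..(1 : ℝ), ((t - s) ^ (-(1 : ℝ) / 2 - H)) • gB s) ≤
      M * ENNReal.ofReal N ^ 2 := by
    rw [hexp, alphaNormSq, ← Ioc_union_Ioi_eq_Ioi (zero_le_one (α := ℝ))]
    refine (lintegral_union_le _ _ _).trans ?_
    rw [hM, add_mul]
    refine add_le_add ?_ ?_
    · have h := intA (gB 0) gB' hg b hb.ne
      rw [hmu] at h
      calc _ ≤ ∫⁻ t in Ioc (0:ℝ) 1, ENNReal.ofReal (2 ^ (2 * α) * αH ^ 2) *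
            ‖(t ^ b) • gB 0 + ∫ s in (0 : ℝ)..t, ((t - s) ^ b) • gB' s‖ₑ ^ 2 := by
            refine setLIntegral_mono' measurableSet_Ioc fun t ht => ?_
            rw [if_pos ht.2, norm_smul, mul_pow, Real.norm_eq_abs, sq_abs, ← mul_assoc,
              ENNReal.ofReal_mul (by have := ht.1; positivity),
              ENNReal.ofReal_pow (norm_nonneg _), ofReal_norm]
            have := ht.1
            gcongr
            linarith [ht.2]
        _ ≤ _ := by
            rw [lintegral_const_mul' _ _ (by finiteness)]
            refine (mul_le_mul_right h _).trans (le_of_eq ?_)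
            ring
    · have h := intB gB N hbd α b hα0 hb
      calc _ = ∫⁻ t in Ioi (1:ℝ), ENNReal.ofReal ((αH * b) ^ 2) * ENNReal.ofReal ((1 + t) ^ (2 * α) *
      ‖∫ s in (0 : ℝ)..(1 : ℝ), ((t - s) ^ (b - 1)) • gB s‖ ^ 2) := by
            refine setLIntegral_congr_fun measurableSet_Ioi fun t ht => ?_
            have ht' : ¬ t ≤ 1 := not_le.2 ht
            simp only [if_neg ht']
            rw [← ENNReal.ofReal_mul (by positivity), norm_smul, mul_pow, Real.norm_eq_abs, sq_abs]
            congr 1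
            ring
        _ ≤ _ := by
            rw [lintegral_const_mul' _ _ (by finiteness)]
            refine (mul_le_mul_right h _).trans (le_of_eq ?_)
            ring
  refine (ENNReal.rpow_le_rpow key (by norm_num)).trans ?_
  rw [ENNReal.mul_rpow_of_nonneg _ _ (by norm_num), ← ENNReal.rpow_natCast, ← ENNReal.rpow_mul,
    ENNReal.ofReal_mul (by positivity)]
  norm_num only
  rw [ENNReal.rpow_one]
  gcongr
  rw [ENNReal.ofReal_add (by positivity) (by norm_num), ENNReal.ofReal_toReal]
  · exact le_self_add
  · convert hM2 using 2
end

section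
/- Let N denote the standard Gaussian measure on ℝ. Choose a ∈ ℝ and b ≥ |a| with b > 0, and set M = max{4b, 2·log(8/b)}. Then there exists a Borel probability measure N²_{a,b} on ℝ² with the following properties: (1) both marginals of N²_{a,b} (pushforwards under the two coordinate projections) are equal to N; (2) the set {(x,y) ∈ ℝ² : |y − x| ≤ M} has N²_{a,b}-measure 1; (3) the diagonal line {(x,y) : y = x + a} has strictly positive N²_{a,b}-measure, and if moreover b ≤ 1, then N²_{a,b}({(x,y) : y = x + a}) > 1 − b. -/
open MeasureTheory Set
open scoped NNReal ENNReal

open ProbabilityTheory in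
/-- Density comparison on a set. -/
lemma gauss_restrict_le (m m' : ℝ) (S : Set ℝ) (hS : MeasurableSet S)
    (h : ∀ x ∈ S, (x - m') ^ 2 ≤ (x - m) ^ 2) :
    (gaussianReal m 1).restrict S ≤ (gaussianReal m' 1).restrict S := by
  rw [gaussianReal_of_var_ne_zero m one_ne_zero, gaussianReal_of_var_ne_zero m' one_ne_zero,
    restrict_withDensity hS, restrict_withDensity hS]
  apply withDensity_mono
  filter_upwards [ae_restrict_mem hS] with x hx
  unfold gaussianPDF
  apply ENNReal.ofReal_le_ofReal
  unfold gaussianPDFReal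
  have := h x hx
  gcongr

/-- Abstract coupling construction. -/
lemma coupling_exists (N : Measure ℝ) [IsProbabilityMeasure N] (I : Set ℝ) (hI : MeasurableSet I)
    (a M : ℝ) (hM : ∀ x ∈ I, ∀ y ∈ I, |y - x| ≤ M) (haM : |a| ≤ M) (ρ : Measure ℝ)
    (h1 : ρ ≤ N.restrict I) (h2 : ρ.map (fun x => x + a) ≤ N.restrict I) :
    ∃ μ : Measure (ℝ × ℝ), IsProbabilityMeasure μ ∧ μ.map Prod.fst = N ∧ μ.map Prod.snd = N ∧
      μ {p : ℝ × ℝ | |p.2 - p.1| ≤ M} = 1 ∧ ρ univ ≤ μ {p : ℝ × ℝ | p.2 = p.1 + a} := by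
  have hM0 : 0 ≤ M := (abs_nonneg a).trans haM
  have hma : Measurable (fun x : ℝ => x + a) := by fun_prop
  have hmp : Measurable (fun x : ℝ => (x, x + a)) := by fun_prop
  have hmd : Measurable (fun x : ℝ => (x, x)) := by fun_prop
  have : IsFiniteMeasure ρ := isFiniteMeasure_of_le _ h1
  set ρ' := ρ.map (fun x => x + a) with hρ'
  have : IsFiniteMeasure ρ' := isFiniteMeasure_of_le _ h2
  set α := N.restrict I - ρ with hα
  set β := N.restrict I - ρ' with hβ
  have hαle : α ≤ N.restrict I := Measure.sub_le
  have hβle : β ≤ N.restrict I := Measure.sub_le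
  have : IsFiniteMeasure α := isFiniteMeasure_of_le _ hαle
  have : IsFiniteMeasure β := isFiniteMeasure_of_le _ hβle
  have hα2 : α + ρ = N.restrict I := Measure.sub_add_cancel_of_le h1
  have hβ2 : β + ρ' = N.restrict I := Measure.sub_add_cancel_of_le h2
  have hmass : α univ = β univ := by
    have e1 : α univ + ρ univ = N.restrict I univ := by rw [← hα2]; rfl
    have e2 : β univ + ρ' univ = N.restrict I univ := by rw [← hβ2]; rfl
    have e3 : ρ' univ = ρ univ := by rw [hρ', Measure.map_apply hma MeasurableSet.univ]; simp
    rw [e3, ← e1] at e2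
    exact ((ENNReal.add_left_inj (measure_ne_top ρ univ)).1 e2).symm
  set γ : Measure (ℝ × ℝ) := (α univ)⁻¹ • α.prod β with hγ
  have hγ1 : γ.map Prod.fst = α := by
    rw [hγ, Measure.map_smul, Measure.map_fst_prod, ← hmass, smul_smul]
    by_cases h0 : α univ = 0
    · rw [Measure.measure_univ_eq_zero.1 h0]; simp
    · rw [ENNReal.inv_mul_cancel h0 (measure_ne_top _ _), one_smul]
  have hγ2 : γ.map Prod.snd = β := by
    rw [hγ, Measure.map_smul, Measure.map_snd_prod, smul_smul, hmass]
    by_cases h0 : β univ = 0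
    · rw [Measure.measure_univ_eq_zero.1 h0]; simp
    · rw [ENNReal.inv_mul_cancel h0 (measure_ne_top _ _), one_smul]
  set μ : Measure (ℝ × ℝ) :=
    γ + ρ.map (fun x => (x, x + a)) + (N.restrict Iᶜ).map (fun x => (x, x)) with hμ
  have hfst : μ.map Prod.fst = N := by
    rw [hμ, Measure.map_add _ _ measurable_fst, Measure.map_add _ _ measurable_fst, hγ1,
      Measure.map_map measurable_fst hmp, Measure.map_map measurable_fst hmd]
    have i1 : Prod.fst ∘ (fun x : ℝ => (x, x + a)) = id := rfl
    have i2 : Prod.fst ∘ (fun x : ℝ => (x, x)) = id := rfl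
    rw [i1, i2, Measure.map_id, Measure.map_id, hα2, Measure.restrict_add_restrict_compl hI]
  have hsnd : μ.map Prod.snd = N := by
    rw [hμ, Measure.map_add _ _ measurable_snd, Measure.map_add _ _ measurable_snd, hγ2,
      Measure.map_map measurable_snd hmp, Measure.map_map measurable_snd hmd]
    have i1 : Prod.snd ∘ (fun x : ℝ => (x, x + a)) = fun x => x + a := rfl
    have i2 : Prod.snd ∘ (fun x : ℝ => (x, x)) = id := rfl
    rw [i1, i2, Measure.map_id, ← hρ', hβ2, Measure.restrict_add_restrict_compl hI]
  have hprob : IsProbabilityMeasure μ := by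
    constructor
    have : μ.map Prod.fst univ = 1 := by rw [hfst]; exact measure_univ
    rwa [Measure.map_apply measurable_fst MeasurableSet.univ, preimage_univ] at this
  have hmeas : MeasurableSet {p : ℝ × ℝ | |p.2 - p.1| ≤ M} :=
    measurableSet_le (by fun_prop) (by fun_prop)
  have hline : MeasurableSet {p : ℝ × ℝ | p.2 = p.1 + a} :=
    measurableSet_eq_fun (by fun_prop) (by fun_prop)
  refine ⟨μ, hprob, hfst, hsnd, ?_, ?_⟩
  · have : ∀ᵐ p ∂μ, |p.2 - p.1| ≤ M := by
      rw [hμ, ae_add_measure_iff, ae_add_measure_iff]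
      refine ⟨⟨?_, ?_⟩, ?_⟩
      · apply Measure.ae_smul_measure
        have hαI : ∀ᵐ x ∂α, x ∈ I :=
          (Measure.absolutelyContinuous_of_le hαle).ae_le (ae_restrict_mem hI)
        have hβI : ∀ᵐ x ∂β, x ∈ I :=
          (Measure.absolutelyContinuous_of_le hβle).ae_le (ae_restrict_mem hI)
        rw [Measure.ae_prod_iff_ae_ae hmeas]
        filter_upwards [hαI] with x hx
        filter_upwards [hβI] with y hy
        exact hM x hx y hy
      · rw [ae_map_iff hmp.aemeasurable hmeas]
        refine Filter.Eventually.of_forall fun x => ?_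
        simpa using haM
      · rw [ae_map_iff hmd.aemeasurable hmeas]
        refine Filter.Eventually.of_forall fun x => ?_
        simpa using hM0
    exact (prob_compl_eq_zero_iff hmeas).1 this
  · have : ρ.map (fun x => (x, x + a)) {p : ℝ × ℝ | p.2 = p.1 + a} = ρ univ := by
      rw [Measure.map_apply hmp hline]; simp
    rw [← this, hμ, Measure.add_apply, Measure.add_apply]
    exact le_self_add.trans' le_add_self

open ProbabilityTheory in
lemma gauss_tail (R b : ℝ) (hb : 0 < b) (hb1 : b ≤ 1) (hR : Real.log (8 / b) ≤ R) :
    gaussianReal 0 1 (Ici R) ≤ ENNReal.ofReal (b / 8) := by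
  have h := measure_ge_le_exp_mul_mgf (X := id) (μ := gaussianReal 0 1) (t := 2) R (by norm_num)
    (integrable_exp_mul_gaussianReal 2)
  rw [mgf_id_gaussianReal, ← Real.exp_add] at h
  have h8 : Real.log 8 = 3 * Real.log 2 := by
    rw [show (8 : ℝ) = 2 ^ 3 by norm_num, Real.log_pow]; norm_num
  have hl := Real.log_two_gt_d9
  have hlb : Real.log (8 / b) = Real.log 8 - Real.log b := Real.log_div (by norm_num) hb.ne'
  have hb' : Real.log b ≤ 0 := Real.log_nonpos hb.le hb1
  have h3 : Real.exp (-Real.log (8 / b)) = b / 8 := by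
    rw [Real.exp_neg, Real.exp_log (by positivity), inv_div]
  have h4 : (gaussianReal 0 1).real {x | R ≤ id x} ≤ b / 8 := by
    rw [← h3]
    refine h.trans (Real.exp_le_exp.2 ?_)
    norm_num
    linarith
  rw [← ENNReal.ofReal_toReal (measure_ne_top (gaussianReal 0 1) (Ici R))]
  exact ENNReal.ofReal_le_ofReal h4

open ProbabilityTheory in
lemma gauss_tail' (R b : ℝ) (hb : 0 < b) (hb1 : b ≤ 1) (hR : Real.log (8 / b) ≤ R) :
    gaussianReal 0 1 (Iic (-R)) ≤ ENNReal.ofReal (b / 8) := by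
  have h : gaussianReal 0 1 = (gaussianReal 0 1).map (fun x => -x) := by
    rw [gaussianReal_map_neg, neg_zero]
  rw [h, Measure.map_apply measurable_neg measurableSet_Iic]
  have : (fun x : ℝ => -x) ⁻¹' Iic (-R) = Ici R := by ext; simp
  rw [this]
  exact gauss_tail R b hb hb1 hR

open ProbabilityTheory in
lemma gauss_mid (a b : ℝ) (hb : 0 < b) (hab : a ≤ b) :
    gaussianReal 0 1 (Ico (-a / 2) (a / 2)) ≤ ENNReal.ofReal (b / 2) := by
  rw [gaussianReal_apply _ one_ne_zero]
  calc ∫⁻ x in Ico (-a / 2) (a / 2), gaussianPDF 0 1 x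
      ≤ ∫⁻ x in Ico (-a / 2) (a / 2), ENNReal.ofReal (1 / 2) := by
        apply lintegral_mono
        intro x
        unfold gaussianPDF
        apply ENNReal.ofReal_le_ofReal
        unfold gaussianPDFReal
        have h1 : (2 : ℝ) ≤ √(2 * Real.pi * (1 : ℝ≥0)) := by
          apply Real.le_sqrt_of_sq_le
          have := Real.pi_gt_three
          norm_num; linarith
        have h2 : Real.exp (-(x - 0) ^ 2 / (2 * (1 : ℝ≥0))) ≤ 1 := by
          apply Real.exp_le_one_iff.2
          have := sq_nonneg (x - 0)
          apply div_nonpos_of_nonpos_of_nonneg <;> [linarith; positivity]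
        have h3 : (√(2 * Real.pi * (1 : ℝ≥0)))⁻¹ ≤ 1 / 2 := by
          rw [one_div]; exact inv_anti₀ (by norm_num) h1
        calc _ ≤ (1 / 2 : ℝ) * 1 := by gcongr
          _ = _ := by norm_num
    _ = ENNReal.ofReal (1 / 2) * ENNReal.ofReal a := by
        rw [setLIntegral_const, Real.volume_Ico]; congr 2; ring
    _ ≤ ENNReal.ofReal (b / 2) := by
        rw [← ENNReal.ofReal_mul (by norm_num)]
        apply ENNReal.ofReal_le_ofReal
        linarith

open ProbabilityTheory in
lemma stmt15_nonneg (a b : ℝ) (ha : 0 ≤ a) (hab : a ≤ b) (hb : 0 < b) :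
    ∃ μ : Measure (ℝ × ℝ), IsProbabilityMeasure μ ∧
      μ.map Prod.fst = ProbabilityTheory.gaussianReal 0 1 ∧
      μ.map Prod.snd = ProbabilityTheory.gaussianReal 0 1 ∧
      μ {p : ℝ × ℝ | |p.2 - p.1| ≤ max (4 * b) (2 * Real.log (8 / b))} = 1 ∧
      0 < μ {p : ℝ × ℝ | p.2 = p.1 + a} ∧
      (b ≤ 1 → 1 - ENNReal.ofReal b < μ {p : ℝ × ℝ | p.2 = p.1 + a}) := by
  set M := max (4 * b) (2 * Real.log (8 / b)) with hM
  have hM1 : 4 * b ≤ M := le_max_left _ _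
  have hM2 : 2 * Real.log (8 / b) ≤ M := le_max_right _ _
  obtain ⟨R, hR⟩ : ∃ R, R = M / 2 := ⟨_, rfl⟩
  have hRb : 2 * b ≤ R := by linarith
  have hRl : Real.log (8 / b) ≤ R := by linarith
  set A : Set ℝ := Ico (-R) (-a / 2) with hA
  set B : Set ℝ := Icc (-a / 2) (R - a) with hB
  set ρ : Measure ℝ := (gaussianReal 0 1).restrict A + (gaussianReal (-a) 1).restrict B with hρ
  have hAm : MeasurableSet A := measurableSet_Ico
  have hBm : MeasurableSet B := measurableSet_Icc
  have hAB : Disjoint A B := by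
    rw [Set.disjoint_left]
    rintro x ⟨_, h1⟩ ⟨h2, _⟩
    linarith
  have hAB' : A ∪ B ⊆ Icc (-R) (R - a) := by
    rintro x (⟨h1, h2⟩ | ⟨h1, h2⟩) <;> constructor <;> linarith
  have hma : Measurable (fun x : ℝ => x + a) := by fun_prop
  have hmap : gaussianReal 0 1 = (gaussianReal (-a) 1).map (fun x => x + a) := by
    rw [gaussianReal_map_add_const, neg_add_cancel]
  have h1 : ρ ≤ (gaussianReal 0 1).restrict (Icc (-R) R) := by
    have : ρ ≤ (gaussianReal 0 1).restrict A + (gaussianReal 0 1).restrict B := by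
      rw [hρ]
      refine add_le_add le_rfl (gauss_restrict_le _ _ _ hBm ?_)
      rintro x ⟨hx, _⟩
      nlinarith
    refine this.trans ?_
    rw [← Measure.restrict_union hAB hBm]
    apply Measure.restrict_mono _ le_rfl
    exact hAB'.trans (Icc_subset_Icc le_rfl (by linarith))
  have h2 : ρ.map (fun x => x + a) ≤ (gaussianReal 0 1).restrict (Icc (-R) R) := by
    have : ρ ≤ (gaussianReal (-a) 1).restrict A + (gaussianReal (-a) 1).restrict B := by
      rw [hρ]
      refine add_le_add (gauss_restrict_le _ _ _ hAm ?_) le_rfl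
      rintro x ⟨_, hx⟩
      nlinarith
    rw [← Measure.restrict_union hAB hBm] at this
    refine (Measure.map_mono this hma).trans ?_
    rw [hmap, Measure.restrict_map hma measurableSet_Icc]
    apply Measure.map_mono _ hma
    apply Measure.restrict_mono _ le_rfl
    intro x hx
    obtain ⟨h1, h2⟩ := hAB' hx
    constructor <;> simp only <;> linarith
  obtain ⟨μ, hp, hf, hs, hd, hl⟩ := coupling_exists (gaussianReal 0 1) (Icc (-R) R)
    measurableSet_Icc a M (by
      rintro x ⟨h1, h2⟩ y ⟨h3, h4⟩
      rw [abs_le]; constructor <;> linarith) (by rw [abs_of_nonneg ha]; linarith) ρ h1 h2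
  have hmassρ : ρ univ = gaussianReal 0 1 A + gaussianReal 0 1 (Icc (a / 2) R) := by
    rw [hρ, Measure.add_apply, Measure.restrict_apply_univ, Measure.restrict_apply_univ]
    congr 1
    rw [hmap, Measure.map_apply hma measurableSet_Icc]
    congr 1
    ext x
    simp only [hB, mem_Icc, mem_preimage]
    constructor <;> rintro ⟨h1, h2⟩ <;> constructor <;> linarith
  refine ⟨μ, hp, hf, hs, hd, lt_of_lt_of_le ?_ hl, fun hb1 => lt_of_lt_of_le ?_ hl⟩
  · rw [hmassρ]
    have : gaussianReal 0 1 (Icc (a / 2) R) ≠ 0 := by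
      intro h
      have := gaussianReal_absolutelyContinuous' 0 one_ne_zero h
      rw [Real.volume_Icc, ENNReal.ofReal_eq_zero] at this
      linarith
    exact lt_of_lt_of_le (pos_iff_ne_zero.2 this) le_add_self
  · have hone : (1 : ℝ≥0∞) ≤ ρ univ + ENNReal.ofReal (3 * b / 4) := by
      have hcov : (univ : Set ℝ) ⊆
          (A ∪ Icc (a / 2) R) ∪ ((Iic (-R) ∪ Ici R) ∪ Ico (-a / 2) (a / 2)) := by
        intro x _
        simp only [hA, mem_union, mem_Ico, mem_Icc, mem_Iic, mem_Ici]
        grind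
      calc (1 : ℝ≥0∞) = gaussianReal 0 1 univ := measure_univ.symm
        _ ≤ _ := measure_mono hcov
        _ ≤ _ := measure_union_le _ _
        _ ≤ (gaussianReal 0 1 A + gaussianReal 0 1 (Icc (a / 2) R)) +
            ((gaussianReal 0 1 (Iic (-R)) + gaussianReal 0 1 (Ici R)) +
              gaussianReal 0 1 (Ico (-a / 2) (a / 2))) := by
            refine add_le_add (measure_union_le _ _) ((measure_union_le _ _).trans ?_)
            exact add_le_add (measure_union_le _ _) le_rfl
        _ ≤ ρ univ + ((ENNReal.ofReal (b / 8) + ENNReal.ofReal (b / 8)) +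
              ENNReal.ofReal (b / 2)) := by
            rw [hmassρ]
            gcongr
            · exact gauss_tail' R b hb hb1 hRl
            · exact gauss_tail R b hb hb1 hRl
            · exact gauss_mid a b hb hab
        _ = _ := by
            rw [← ENNReal.ofReal_add (by positivity) (by positivity),
              ← ENNReal.ofReal_add (by positivity) (by positivity)]
            congr 2; ring
    have e : (1 : ℝ≥0∞) - ENNReal.ofReal b = ENNReal.ofReal (1 - b) := by
      rw [ENNReal.ofReal_sub _ hb.le, ENNReal.ofReal_one]
    rw [e]
    by_contra! hcon
    have := hone.trans (add_le_add hcon le_rfl)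
    rw [← ENNReal.ofReal_add (by linarith) (by positivity), ← ENNReal.ofReal_one,
      ENNReal.ofReal_le_ofReal_iff (by linarith)] at this
    linarith

/-- Lemma 5.13: for `a ∈ ℝ`, `b ≥ |a|`, `b > 0` and `M = max{4b, 2 log(8/b)}`,
there is a coupling `N²_{a,b}` of two standard Gaussians on `ℝ²` which gives full
mass to `{|y - x| ≤ M}`, gives positive mass to the line `{y = x + a}`, and gives
this line mass `> 1 - b` whenever `b ≤ 1`. -/
theorem stmt15 (a b : ℝ) (hab : |a| ≤ b) (hb : 0 < b) :
    ∃ μ : Measure (ℝ × ℝ), IsProbabilityMeasure μ ∧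
      μ.map Prod.fst = ProbabilityTheory.gaussianReal 0 1 ∧
      μ.map Prod.snd = ProbabilityTheory.gaussianReal 0 1 ∧
      μ {p : ℝ × ℝ | |p.2 - p.1| ≤ max (4 * b) (2 * Real.log (8 / b))} = 1 ∧
      0 < μ {p : ℝ × ℝ | p.2 = p.1 + a} ∧
      (b ≤ 1 → 1 - ENNReal.ofReal b < μ {p : ℝ × ℝ | p.2 = p.1 + a}) := by
  rcases le_total 0 a with ha | ha
  · exact stmt15_nonneg a b ha (by rwa [abs_of_nonneg ha] at hab) hb
  · obtain ⟨μ, hp, hf, hs, hd, hl, hl'⟩ :=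
      stmt15_nonneg (-a) b (by linarith) (by rwa [abs_of_nonpos ha] at hab) hb
    have hline : MeasurableSet {p : ℝ × ℝ | p.2 = p.1 + a} :=
      measurableSet_eq_fun (by fun_prop) (by fun_prop)
    have hmeas : MeasurableSet
        {p : ℝ × ℝ | |p.2 - p.1| ≤ max (4 * b) (2 * Real.log (8 / b))} :=
      measurableSet_le (by fun_prop) (by fun_prop)
    have e1 : μ.map Prod.swap {p : ℝ × ℝ | p.2 = p.1 + a} = μ {p : ℝ × ℝ | p.2 = p.1 + -a} := by
      rw [Measure.map_apply measurable_swap hline]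
      congr 1
      ext p
      simp only [mem_preimage, mem_ofPred_eq, Prod.fst_swap, Prod.snd_swap]
      constructor <;> intro h <;> linarith
    refine ⟨μ.map Prod.swap, Measure.isProbabilityMeasure_map measurable_swap.aemeasurable,
      ?_, ?_, ?_, ?_, ?_⟩
    · rw [Measure.map_map measurable_fst measurable_swap]; exact hs
    · rw [Measure.map_map measurable_snd measurable_swap]; exact hf
    · rw [Measure.map_apply measurable_swap hmeas, ← hd]
      congr 1
      ext p
      simp only [mem_preimage, mem_ofPred_eq, Prod.fst_swap, Prod.snd_swap, abs_sub_comm]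
    · rwa [e1]
    · rwa [e1]
end
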